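/- arXiv:0810.3365 — 7 statements merged into one kernel-verified Lean document; each statement's English description precedes it below -/
import Mathlib

section
/- Let A be a complex associative unital star-algebra, with commutator ⁅x,y⁆ := x*y − y*x, let b, c ∈ ℝ, and let p, q, H, E ∈ A satisfy star p = p, star q = q, star H = −H, star E = E, ⁅p, q⁆ = H, ⁅q, H⁆ = c·E, ⁅H, p⁆ = b·E, and ⁅E, p⁆ = ⁅E, q⁆ = ⁅E, H⁆ = 0. Define z := 2c + 2bi, a† := p + i·q, a := p − i·q, h := 2i·H. Then star a = a†, star h = h, and the centrally extended Heisenberg commutation relations ⁅a, a†⁆ = h, ⁅h, a†⁆ = z·E, ⁅a, h⁆ = conj(z)·E hold. -/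
open Complex

/-- Converse of the real-form correspondence: from `p, q, H, E` with `⁅p,q⁆ = H`,
`⁅q,H⁆ = c·E`, `⁅H,p⁆ = b·E`, setting `z = 2c + 2bi`, `a† = p + iq`, `a = p − iq`,
`h = 2iH` yields the centrally extended Heisenberg commutation relations. -/
theorem stmt_3 {A : Type*} [Ring A] [Algebra ℂ A] [StarRing A] [StarModule ℂ A]
    (b c : ℝ) (p q H E : A)
    (hsp : star p = p) (hsq : star q = q) (hsH : star H = -H) (hsE : star E = E)
    (h1 : p * q - q * p = H)
    (h2 : q * H - H * q = ((c : ℂ)) • E)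
    (h3 : H * p - p * H = ((b : ℂ)) • E)
    (h4 : E * p - p * E = 0) (h5 : E * q - q * E = 0) (h6 : E * H - H * E = 0) :
    let z : ℂ := 2 * c + 2 * b * I
    let ad := p + I • q
    let a := p - I • q
    let h := (2 * I) • H
    star a = ad ∧ star h = h ∧
    a * ad - ad * a = h ∧
    h * ad - ad * h = z • E ∧
    a * h - h * a = (starRingEnd ℂ z) • E := by
  have hI : I * I = -1 := I_mul_I
  intro z ad a h
  refine ⟨?_, ?_, ?_, ?_, ?_⟩
  · simp [a, ad, hsp, hsq, star_smul]
  · simp [h, hsH, star_smul]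
  · have e : a * ad - ad * a = (2 * I) • (p * q - q * p) := by
      simp only [a, ad, mul_add, add_mul, sub_mul, mul_sub, smul_mul_assoc, mul_smul_comm]
      module
    rw [e, h1]
  · have e : h * ad - ad * h
        = (2 * I) • (H * p - p * H) - (2 * (I * I)) • (q * H - H * q) := by
      simp only [h, ad, mul_add, add_mul, smul_mul_assoc, mul_smul_comm]
      module
    rw [e, h2, h3, hI]
    simp only [z]
    module
  · have e : a * h - h * a
        = -((2 * I) • (H * p - p * H)) - (2 * (I * I)) • (q * H - H * q) := by
      simp only [h, a, mul_sub, sub_mul, smul_mul_assoc, mul_smul_comm]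
      module
    have hz : (starRingEnd ℂ) z = 2 * c - 2 * b * I := by
      simp [z, sub_eq_add_neg, Complex.conj_ofNat]
    rw [e, h2, h3, hI, hz]
    module
end

section
/- Let A be a complex associative unital star-algebra, with commutator ⁅x,y⁆ := x*y − y*x, and let b, b† ∈ A satisfy ⁅b, b†⁆ = 1 and star b = b†. Let z ∈ ℂ with Re z ≠ 0, and let ρ, r ∈ ℝ with r ≠ 0. Define a := ((4ρ·Im z − r²)/(4·Re z) + iρ)·(b − b†)² − (i·conj(z)/(2r))·(b + b†), a† := ((4ρ·Im z − r²)/(4·Re z) − iρ)·(b − b†)² + (i·z/(2r))·(b + b†), and h := i·r·(b† − b). Then star a = a†, star h = h, and ⁅a, a†⁆ = h, ⁅h, a†⁆ = z·1, ⁅a, h⁆ = conj(z)·1. -/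
open Complex

lemma aux_comm {A : Type*} [Ring A] [Algebra ℂ A] (p q : A) (hpq : p * q - q * p = (2 : ℂ) • (1 : A))
    (α β γ δ η : ℂ) :
    (α • p ^ 2 - β • q) * (δ • p ^ 2 + γ • q) - (δ • p ^ 2 + γ • q) * (α • p ^ 2 - β • q)
      = (4 * (α * γ + β * δ)) • p ∧
    (η • p) * (δ • p ^ 2 + γ • q) - (δ • p ^ 2 + γ • q) * (η • p) = (2 * η * γ) • (1 : A) ∧
    (α • p ^ 2 - β • q) * (η • p) - (η • p) * (α • p ^ 2 - β • q) = (2 * η * β) • (1 : A) := by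
  have h1 : p * q = q * p + (2 : ℂ) • (1 : A) := by rw [← hpq]; abel
  have h2 : p ^ 2 * q = q * p ^ 2 + (4 : ℂ) • p := by
    rw [pow_two, mul_assoc, h1, mul_add, ← mul_assoc, h1]
    simp only [add_mul, mul_smul_comm, smul_mul_assoc, mul_one, one_mul, mul_assoc]
    module
  have h3 : p * p ^ 2 = p ^ 2 * p := by rw [← pow_succ', ← pow_succ]
  refine ⟨?_, ?_, ?_⟩ <;>
  · simp only [add_mul, mul_add, sub_mul, mul_sub, mul_smul_comm, smul_mul_assoc, h1, h2, h3]
    module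

/-- Boson representation of `CEHeis` in the case `Re z ≠ 0`. -/
theorem stmt_7 {A : Type*} [Ring A] [Algebra ℂ A] [StarRing A] [StarModule ℂ A]
    (b bd : A) (hccr : b * bd - bd * b = 1) (hstar : star b = bd)
    (z : ℂ) (hz : z.re ≠ 0) (ρ r : ℝ) (hr : r ≠ 0) :
    let a := (((4 * ρ * z.im - r ^ 2) / (4 * z.re) : ℝ) + I * (ρ : ℂ)) • (b - bd) ^ 2
      - (I * (starRingEnd ℂ z) / (2 * (r : ℂ))) • (b + bd)
    let ad := (((4 * ρ * z.im - r ^ 2) / (4 * z.re) : ℝ) - I * (ρ : ℂ)) • (b - bd) ^ 2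
      + (I * z / (2 * (r : ℂ))) • (b + bd)
    let h := (I * (r : ℂ)) • (bd - b)
    star a = ad ∧ star h = h ∧
    a * ad - ad * a = h ∧
    h * ad - ad * h = z • (1 : A) ∧
    a * h - h * a = (starRingEnd ℂ z) • (1 : A) := by
  intro a ad h
  have hs2 : star bd = b := by rw [← hstar, star_star]
  have hpq : (b - bd) * (b + bd) - (b + bd) * (b - bd) = (2 : ℂ) • (1 : A) := by
    rw [← hccr, two_smul]; noncomm_ring
  have hh : h = (-(I * (r : ℂ))) • (b - bd) := by
    simp only [h]; module
  have hrc : (r : ℂ) ≠ 0 := by exact_mod_cast hr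
  obtain ⟨c1, c2, c3⟩ := aux_comm (b - bd) (b + bd) hpq
    (((4 * ρ * z.im - r ^ 2) / (4 * z.re) : ℝ) + I * (ρ : ℂ))
    (I * (starRingEnd ℂ z) / (2 * (r : ℂ))) (I * z / (2 * (r : ℂ)))
    (((4 * ρ * z.im - r ^ 2) / (4 * z.re) : ℝ) - I * (ρ : ℂ)) (-(I * (r : ℂ)))
  refine ⟨?_, ?_, ?_, ?_, ?_⟩
  · have hsq : (bd - b) ^ 2 = (b - bd) ^ 2 := by noncomm_ring
    simp only [a, ad, star_sub, star_smul, star_pow, star_add, hstar, hs2, hsq, add_comm bd b]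
    rw [sub_eq_add_neg, ← neg_smul]
    congr 2
    · simp [sub_eq_add_neg]
    · simp [neg_div]
  · simp only [h, star_smul, star_sub, hstar, hs2]
    simp
    module
  · rw [hh]
    refine c1.trans ?_
    congr 1
    have hzc : (z.re : ℂ) ≠ 0 := by exact_mod_cast hz
    have e1 : z = z.re + z.im * I := (re_add_im z).symm
    have e2 : starRingEnd ℂ z = z.re - z.im * I := by
      apply Complex.ext <;> simp
    rw [e2]
    generalize hx : z.re = x at *
    generalize hy : z.im = y at *
    rw [e1]
    push_cast
    field_simp
    ring_nf
    simp only [I_sq, show I ^ 3 = -I from I_pow_three]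
    ring
  · rw [hh]
    refine c2.trans ?_
    congr 1
    field_simp
    simp
  · rw [hh]
    refine c3.trans ?_
    congr 1
    field_simp
    simp
end

section
/- Let L ∈ ℝ and M, N ∈ ℂ. Define, for real s with 2Ls + 1 > 0: w₁(s) := Ls/(2Ls + 1), w₂(s) := (L(M + N)s² + Ns)/(2Ls + 1), and w₃(s) := ((M + N)²(L²s⁴ + 2Ls³) + 3MNs²)/(6(2Ls + 1)) − (1/2)·log(2Ls + 1). Then w₁(0) = w₂(0) = w₃(0) = 0, and for every real s with 2Ls + 1 > 0 the functions are differentiable at s with w₁′(s) = 4L·w₁(s)² − 4L·w₁(s) + L, w₂′(s) = (4L·w₁(s) − 2L)·w₂(s) + 2M·w₁(s) + N, and w₃′(s) = 2L·w₁(s) + L·w₂(s)² − L + M·w₂(s). -/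
/-- The coefficient functions `w₁, w₂, w₃` of the splitting formula vanish at `0`
and satisfy the Riccati, linear, and direct-integration differential equations on
the interval where `2Ls + 1 > 0`. -/
theorem stmt_9 (L : ℝ) (M N : ℂ) :
    let w₁ : ℝ → ℂ := fun s => (L : ℂ) * s / (2 * L * s + 1)
    let w₂ : ℝ → ℂ := fun s => ((L : ℂ) * (M + N) * s ^ 2 + N * s) / (2 * L * s + 1)
    let w₃ : ℝ → ℂ := fun s =>
      ((M + N) ^ 2 * ((L : ℂ) ^ 2 * s ^ 4 + 2 * L * s ^ 3) + 3 * M * N * s ^ 2) /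
        (6 * (2 * L * s + 1)) - ((Real.log (2 * L * s + 1) : ℝ) : ℂ) / 2
    w₁ 0 = 0 ∧ w₂ 0 = 0 ∧ w₃ 0 = 0 ∧
    ∀ s : ℝ, 2 * L * s + 1 > 0 →
      HasDerivAt w₁ (4 * L * (w₁ s) ^ 2 - 4 * L * (w₁ s) + L) s ∧
      HasDerivAt w₂ ((4 * L * (w₁ s) - 2 * L) * (w₂ s) + 2 * M * (w₁ s) + N) s ∧
      HasDerivAt w₃ (2 * L * (w₁ s) + L * (w₂ s) ^ 2 - L + M * (w₂ s)) s := by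
  intro w₁ w₂ w₃
  refine ⟨by simp [w₁], by simp [w₂], by simp [w₃], ?_⟩
  intro s hs
  have hD : (2 * (L : ℂ) * s + 1) ≠ 0 := by
    have h : ((2 * L * s + 1 : ℝ) : ℂ) ≠ 0 := Complex.ofReal_ne_zero.mpr hs.ne'
    push_cast at h
    exact h
  have hx : HasDerivAt (fun t : ℝ => (t : ℂ)) 1 s := Complex.ofRealCLM.hasDerivAt
  have hd : HasDerivAt (fun t : ℝ => 2 * (L : ℂ) * t + 1) (2 * (L : ℂ) * 1) s :=
    (hx.const_mul (2 * (L : ℂ))).add_const 1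
  have hp : ∀ n : ℕ, HasDerivAt (fun t : ℝ => (t : ℂ) ^ n) (n * (s : ℂ) ^ (n - 1) * 1) s :=
    fun n => hx.fun_pow n
  have hlr : HasDerivAt (fun t : ℝ => Real.log (2 * L * t + 1))
      ((2 * L * 1) / (2 * L * s + 1)) s :=
    (((hasDerivAt_id s).const_mul (2 * L)).add_const 1).log hs.ne'
  have hl := hlr.ofReal_comp
  refine ⟨?_, ?_, ?_⟩
  · refine ((hx.const_mul (L : ℂ)).fun_div hd hD).congr_deriv ?_
    simp only [w₁]
    push_cast
    clear hp hd hx hl hlr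
    generalize hDe : 2 * (L : ℂ) * (s : ℂ) + 1 = D at *
    field_simp
    rw [← hDe]
    ring
  · refine ((((hp 2).const_mul ((L : ℂ) * (M + N))).fun_add (hx.const_mul N)).fun_div
      hd hD).congr_deriv ?_
    simp only [w₁, w₂]
    push_cast
    clear hp hd hx hl hlr
    generalize hDe : 2 * (L : ℂ) * (s : ℂ) + 1 = D at *
    field_simp
    rw [← hDe]
    ring
  · have h6 : (6 * (2 * (L : ℂ) * s + 1)) ≠ 0 := mul_ne_zero (by norm_num) hD
    refine ((((((hp 4).const_mul ((L : ℂ) ^ 2)).fun_add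
      ((hp 3).const_mul (2 * (L : ℂ)))).const_mul ((M + N) ^ 2)).fun_add
      ((hp 2).const_mul (3 * M * N))).fun_div (hd.const_mul 6) h6).fun_sub
      (hl.div_const 2) |>.congr_deriv ?_
    simp only [w₁, w₂]
    push_cast
    clear hp hd hx hl hlr
    generalize hDe : 2 * (L : ℂ) * (s : ℂ) + 1 = D at *
    field_simp
    rw [← hDe]
    ring
end

section
/- Let A be a complex associative unital star-algebra, with commutator ⁅x,y⁆ := x*y − y*x, and let q₁, q₂, p₁, p₂ ∈ A satisfy star qⱼ = qⱼ, star pⱼ = pⱼ, ⁅qⱼ, pₖ⁆ = (i/2)·δⱼₖ·1, and ⁅qⱼ, qₖ⁆ = ⁅pⱼ, pₖ⁆ = 0 for j, k ∈ {1, 2}. Let z ∈ ℂ with Re z ≠ 0 and Im z ≠ 0. Define a := i·Re z·q₁ + (1/Re z)·p₁² − Im z·p₂ − (i/Im z)·q₂², a† := −i·Re z·q₁ + (1/Re z)·p₁² − Im z·p₂ + (i/Im z)·q₂², and h := −2·(p₁ + q₂). Then star a = a†, star h = h, and ⁅a, a†⁆ = h, ⁅h, a†⁆ = z·1, ⁅a,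 h⁆ = conj(z)·1. -/
open Complex

/-- Representation of `CEHeis` in terms of two independent CCR copies, case
`Re z ≠ 0` and `Im z ≠ 0`. -/
theorem stmt_10 {A : Type*} [Ring A] [Algebra ℂ A] [StarRing A] [StarModule ℂ A]
    (q₁ q₂ p₁ p₂ : A)
    (hq₁ : star q₁ = q₁) (hq₂ : star q₂ = q₂) (hp₁ : star p₁ = p₁) (hp₂ : star p₂ = p₂)
    (h₁₁ : q₁ * p₁ - p₁ * q₁ = (I / 2) • (1 : A))
    (h₂₂ : q₂ * p₂ - p₂ * q₂ = (I / 2) • (1 : A))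
    (h₁₂ : q₁ * p₂ - p₂ * q₁ = 0) (h₂₁ : q₂ * p₁ - p₁ * q₂ = 0)
    (hqq : q₁ * q₂ - q₂ * q₁ = 0) (hpp : p₁ * p₂ - p₂ * p₁ = 0)
    (z : ℂ) (hre : z.re ≠ 0) (him : z.im ≠ 0) :
    let a := (I * (z.re : ℂ)) • q₁ + (1 / (z.re : ℂ)) • p₁ ^ 2
      - (z.im : ℂ) • p₂ - (I / (z.im : ℂ)) • q₂ ^ 2
    let ad := (-(I * (z.re : ℂ))) • q₁ + (1 / (z.re : ℂ)) • p₁ ^ 2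
      - (z.im : ℂ) • p₂ + (I / (z.im : ℂ)) • q₂ ^ 2
    let h := (-2 : ℂ) • (p₁ + q₂)
    star a = ad ∧ star h = h ∧
    a * ad - ad * a = h ∧
    h * ad - ad * h = z • (1 : A) ∧
    a * h - h * a = (starRingEnd ℂ z) • (1 : A) := by
  have e1 : q₁ * p₁ = p₁ * q₁ + (I / 2) • (1 : A) := by rw [← h₁₁]; abel
  have e2 : q₂ * p₂ = p₂ * q₂ + (I / 2) • (1 : A) := by rw [← h₂₂]; abel
  have e3 : q₁ * p₂ = p₂ * q₁ := sub_eq_zero.mp h₁₂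
  have e4 : q₂ * p₁ = p₁ * q₂ := sub_eq_zero.mp h₂₁
  have e5 : q₂ * q₁ = q₁ * q₂ := (sub_eq_zero.mp hqq).symm
  have e6 : p₂ * p₁ = p₁ * p₂ := (sub_eq_zero.mp hpp).symm
  have f1 (x : A) : q₁ * (p₁ * x) = p₁ * (q₁ * x) + (I / 2) • x := by
    rw [← mul_assoc, e1, add_mul, mul_assoc, smul_mul_assoc, one_mul]
  have f2 (x : A) : q₂ * (p₂ * x) = p₂ * (q₂ * x) + (I / 2) • x := by
    rw [← mul_assoc, e2, add_mul, mul_assoc, smul_mul_assoc, one_mul]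
  have f3 (x : A) : q₁ * (p₂ * x) = p₂ * (q₁ * x) := by rw [← mul_assoc, e3, mul_assoc]
  have f4 (x : A) : q₂ * (p₁ * x) = p₁ * (q₂ * x) := by rw [← mul_assoc, e4, mul_assoc]
  have f5 (x : A) : q₂ * (q₁ * x) = q₁ * (q₂ * x) := by rw [← mul_assoc, e5, mul_assoc]
  have f6 (x : A) : p₂ * (p₁ * x) = p₁ * (p₂ * x) := by rw [← mul_assoc, e6, mul_assoc]
  have hre' : (z.re : ℂ) ≠ 0 := by exact_mod_cast hre
  have him' : (z.im : ℂ) ≠ 0 := by exact_mod_cast him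
  have hI : I ^ 2 = -1 := I_sq
  have hz : z = (z.re : ℂ) + z.im * I := (re_add_im z).symm
  have hzc : starRingEnd ℂ z = (z.re : ℂ) - z.im * I := by
    apply Complex.ext <;> simp
  intro a ad h
  refine ⟨?_, ?_, ?_, ?_, ?_⟩
  · simp only [a, ad, star_add, star_sub, star_smul, star_pow, hq₁, hq₂, hp₁, hp₂]
    simp
    module
  · simp [h, hq₂, hp₁]
  · simp only [a, ad, h, pow_two, mul_add, add_mul, mul_sub, sub_mul, smul_mul_assoc,
      mul_smul_comm, mul_assoc, e1, e2, e3, e4, e5, e6, f1, f2, f3, f4, f5, f6, smul_add, mul_one]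
    match_scalars <;> field_simp <;> first | ring1 | (ring_nf; simp only [hI]; ring1)
  · have hz1 : z • (1 : A) = ((z.re : ℂ) + z.im * I) • (1 : A) := congrArg (· • (1 : A)) hz
    rw [hz1]
    simp only [ad, h, pow_two, mul_add, add_mul, mul_sub, sub_mul, smul_mul_assoc,
      mul_smul_comm, mul_assoc, e1, e2, e3, e4, e5, e6, f1, f2, f3, f4, f5, f6, smul_add, mul_one]
    match_scalars <;> field_simp <;> first | ring1 | (ring_nf; simp only [hI]; ring1)
  · rw [hzc]
    simp only [a, h, pow_two, mul_add, add_mul, mul_sub, sub_mul, smul_mul_assoc,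
      mul_smul_comm, mul_assoc, e1, e2, e3, e4, e5, e6, f1, f2, f3, f4, f5, f6, smul_add, mul_one]
    match_scalars <;> field_simp <;> first | ring1 | (ring_nf; simp only [hI]; ring1)
end

section
/- Let A be a complex associative unital star-algebra, with commutator ⁅x,y⁆ := x*y − y*x, and let q₁, q₂, p₁, p₂ ∈ A satisfy star qⱼ = qⱼ, star pⱼ = pⱼ, ⁅qⱼ, pₖ⁆ = (i/2)·δⱼₖ·1, and ⁅qⱼ, qₖ⁆ = ⁅pⱼ, pₖ⁆ = 0 for j, k ∈ {1, 2}. Let z ∈ ℂ with Re z = 0 and Im z ≠ 0, and let r ∈ ℝ, c ∈ ℂ be arbitrary. Define a := c·p₁² − Im z·p₂ + (r − i/Im z)·q₂², a† := conj(c)·p₁² − Im z·p₂ + (r + i/Im z)·q₂², and h := −2·q₂. Then star a = a†, star h = h, and ⁅a, a†⁆ = h, ⁅h, a†⁆ = z·1, ⁅a, h⁆ = conj(z)·1. -/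
open Complex

/-- Representation of `CEHeis` in terms of two independent CCR copies, case
`Re z = 0` and `Im z ≠ 0`. -/
theorem stmt_11 {A : Type*} [Ring A] [Algebra ℂ A] [StarRing A] [StarModule ℂ A]
    (q₁ q₂ p₁ p₂ : A)
    (hq₁ : star q₁ = q₁) (hq₂ : star q₂ = q₂) (hp₁ : star p₁ = p₁) (hp₂ : star p₂ = p₂)
    (h₁₁ : q₁ * p₁ - p₁ * q₁ = (I / 2) • (1 : A))
    (h₂₂ : q₂ * p₂ - p₂ * q₂ = (I / 2) • (1 : A))
    (h₁₂ : q₁ * p₂ - p₂ * q₁ = 0) (h₂₁ : q₂ * p₁ - p₁ * q₂ = 0)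
    (hqq : q₁ * q₂ - q₂ * q₁ = 0) (hpp : p₁ * p₂ - p₂ * p₁ = 0)
    (z : ℂ) (hre : z.re = 0) (him : z.im ≠ 0) (r : ℝ) (c : ℂ) :
    let a := c • p₁ ^ 2 - (z.im : ℂ) • p₂ + ((r : ℂ) - I / (z.im : ℂ)) • q₂ ^ 2
    let ad := (starRingEnd ℂ c) • p₁ ^ 2 - (z.im : ℂ) • p₂
      + ((r : ℂ) + I / (z.im : ℂ)) • q₂ ^ 2
    let h := (-2 : ℂ) • q₂
    star a = ad ∧ star h = h ∧
    a * ad - ad * a = h ∧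
    h * ad - ad * h = z • (1 : A) ∧
    a * h - h * a = (starRingEnd ℂ z) • (1 : A) := by
  have hz : z = (z.im : ℂ) * I := by
    apply Complex.ext <;> simp [hre]
  have hzc : starRingEnd ℂ z = -((z.im : ℂ) * I) := by
    apply Complex.ext <;> simp [hre]
  have hm : (z.im : ℂ) ≠ 0 := by exact_mod_cast him
  generalize hmm : (z.im : ℂ) = m at *
  have hmc : starRingEnd ℂ m = m := by rw [← hmm]; exact Complex.conj_ofReal _
  have cqp : Commute p₁ q₂ := (sub_eq_zero.mp h₂₁).symm
  have cpp : Commute p₁ p₂ := sub_eq_zero.mp hpp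
  have e1 : p₁ ^ 2 * q₂ = q₂ * p₁ ^ 2 := (cqp.pow_left 2).eq
  have e2 : p₁ ^ 2 * p₂ = p₂ * p₁ ^ 2 := (cpp.pow_left 2).eq
  have e3 : p₁ ^ 2 * q₂ ^ 2 = q₂ ^ 2 * p₁ ^ 2 := (cqp.pow_pow 2 2).eq
  have e4 : q₂ * p₂ = p₂ * q₂ + (I / 2) • (1 : A) := by rw [← h₂₂]; abel
  have e5 : q₂ ^ 2 * p₂ = p₂ * q₂ ^ 2 + I • q₂ := by
    have : q₂ ^ 2 * p₂ = q₂ * (q₂ * p₂) := by rw [sq, mul_assoc]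
    rw [this, e4, mul_add, ← mul_assoc, e4, add_mul, sq, mul_assoc]
    simp only [smul_mul_assoc, mul_smul_comm, one_mul, mul_one]
    module
  have e6 : q₂ ^ 2 * q₂ = q₂ * q₂ ^ 2 := (Commute.pow_self q₂ 2).eq
  intro a ad h
  refine ⟨?_, ?_, ?_, ?_, ?_⟩
  · simp only [a, ad, star_add, star_sub, star_smul, star_pow, hp₁, hp₂, hq₂]
    simp [hmc, neg_div]
  · simp [h, star_smul, hq₂]
  · simp only [a, ad, h, add_mul, mul_add, sub_mul, mul_sub, smul_mul_assoc, mul_smul_comm,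
      e2, e3, e5]
    match_scalars <;> field_simp <;> ring_nf <;> simp
  · rw [hz]
    simp only [ad, h, add_mul, mul_add, sub_mul, mul_sub, smul_mul_assoc, mul_smul_comm,
      e1, e4, e6]
    module
  · rw [hzc]
    simp only [a, h, add_mul, mul_add, sub_mul, mul_sub, smul_mul_assoc, mul_smul_comm,
      e1, e4, e6]
    module
end

section
/- Let A be a complex associative unital star-algebra, with commutator ⁅x,y⁆ := x*y − y*x, and let q₁, q₂, p₁, p₂ ∈ A satisfy star qⱼ = qⱼ, star pⱼ = pⱼ, ⁅qⱼ, pₖ⁆ = (i/2)·δⱼₖ·1, and ⁅qⱼ, qₖ⁆ = ⁅pⱼ, pₖ⁆ = 0 for j, k ∈ {1, 2}. Let z ∈ ℂ with Re z ≠ 0 and Im z = 0, and let r ∈ ℝ, c ∈ ℂ be arbitrary. Define a := i·Re z·q₁ + (1/Re z + i·r)·p₁² + c·q₂², a† := −i·Re z·q₁ + (1/Re z − i·r)·p₁² + conj(c)·q₂², and h := −2·p₁. Then star a = a†, star h = h, and ⁅a, a†⁆ = h, ⁅h, a†⁆ = z·1, ⁅a, h⁆ = conj(z)·1. -/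
open Complex

/-- Representation of `CEHeis` in terms of two independent CCR copies, case
`Re z ≠ 0` and `Im z = 0`. -/
theorem stmt_12 {A : Type*} [Ring A] [Algebra ℂ A] [StarRing A] [StarModule ℂ A]
    (q₁ q₂ p₁ p₂ : A)
    (hq₁ : star q₁ = q₁) (hq₂ : star q₂ = q₂) (hp₁ : star p₁ = p₁) (hp₂ : star p₂ = p₂)
    (h₁₁ : q₁ * p₁ - p₁ * q₁ = (I / 2) • (1 : A))
    (h₂₂ : q₂ * p₂ - p₂ * q₂ = (I / 2) • (1 : A))
    (h₁₂ : q₁ * p₂ - p₂ * q₁ = 0) (h₂₁ : q₂ * p₁ - p₁ * q₂ = 0)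
    (hqq : q₁ * q₂ - q₂ * q₁ = 0) (hpp : p₁ * p₂ - p₂ * p₁ = 0)
    (z : ℂ) (hre : z.re ≠ 0) (him : z.im = 0) (r : ℝ) (c : ℂ) :
    let a := (I * (z.re : ℂ)) • q₁ + (1 / (z.re : ℂ) + I * (r : ℂ)) • p₁ ^ 2 + c • q₂ ^ 2
    let ad := (-(I * (z.re : ℂ))) • q₁ + (1 / (z.re : ℂ) - I * (r : ℂ)) • p₁ ^ 2
      + (starRingEnd ℂ c) • q₂ ^ 2
    let h := (-2 : ℂ) • p₁
    star a = ad ∧ star h = h ∧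
    a * ad - ad * a = h ∧
    h * ad - ad * h = z • (1 : A) ∧
    a * h - h * a = (starRingEnd ℂ z) • (1 : A) := by
  intro a ad h
  have hz : z = (z.re : ℂ) := by
    apply Complex.ext <;> simp [him]
  have hx : (z.re : ℂ) ≠ 0 := by exact_mod_cast hre
  have e1 : q₁ * p₁ = p₁ * q₁ + (I / 2) • (1 : A) := by rw [← h₁₁]; abel
  have c1 : Commute q₁ (q₂ ^ 2) := Commute.pow_right (sub_eq_zero.mp hqq) 2
  have c2 : Commute p₁ (q₂ ^ 2) := Commute.pow_right (sub_eq_zero.mp h₂₁).symm 2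
  have c3 : Commute (p₁ ^ 2) (q₂ ^ 2) := c2.pow_left 2
  have c4 : Commute p₁ (p₁ ^ 2) := (Commute.refl p₁).pow_right 2
  have e2 : q₁ * p₁ ^ 2 = p₁ ^ 2 * q₁ + I • p₁ := by
    rw [pow_two, ← mul_assoc, e1, add_mul, mul_assoc, e1, mul_add, ← mul_assoc]
    simp only [smul_mul_assoc, mul_smul_comm, one_mul, mul_one]
    module
  have hI : I * I = -1 := I_mul_I
  refine ⟨?_, ?_, ?_, ?_, ?_⟩
  · simp [a, ad, star_smul, hq₁, hq₂, hp₁, sub_eq_add_neg]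
  · simp [h, star_smul, hp₁]
  · have key : ∀ x y y' d d' : ℂ, ∀ P Q : A, q₁ * P = P * q₁ + I • p₁ → q₁ * Q = Q * q₁ →
        P * Q = Q * P →
        (x • q₁ + y • P + d • Q) * ((-x) • q₁ + y' • P + d' • Q)
          - ((-x) • q₁ + y' • P + d' • Q) * (x • q₁ + y • P + d • Q)
          = (x * I * (y + y')) • p₁ := by
      intro x y y' d d' P Q h1 h2 h3
      simp only [mul_add, add_mul, smul_mul_assoc, mul_smul_comm, h1, h2, h3]
      module
    simp only [a, ad, h]
    rw [key _ _ _ _ _ _ _ e2 c1 c3]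
    congr 1
    field_simp
    linear_combination (2 : ℂ) * hI
  · simp only [a, ad, h]
    simp only [mul_add, add_mul, smul_mul_assoc, mul_smul_comm, e1, c2.eq, c4.eq]
    rw [hz]
    simp only [ofReal_re]
    match_scalars <;> first | (linear_combination (-(z.re : ℂ)) * hI) | (linear_combination (0 : ℂ) * hI)
  · simp only [a, ad, h]
    simp only [mul_add, add_mul, smul_mul_assoc, mul_smul_comm, e1, c2.eq, c4.eq]
    rw [hz, conj_ofReal]
    simp only [ofReal_re]
    match_scalars <;> first | (linear_combination (-(z.re : ℂ)) * hI) | (linear_combination (0 : ℂ) * hI)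
end

section
/- Let z ∈ ℂ. The binary operation on ℝ³ × ℂ defined by (α, β, γ, δ) * (A, B, C, D) := (α + A, β + B + γ·A, γ + C, (γ·A²/2 + β·A)·z + (γ²·A/2 + γ·B)·conj(z) + δ + D) is a group law: it is associative, (0, 0, 0, 0) is a two-sided identity element, and every element has a two-sided inverse. -/
/-- The composition law of the centrally extended Heisenberg group on `ℝ³ × ℂ` is a
group law: associative, with `(0,0,0,0)` a two-sided identity and two-sided inverses. -/
theorem stmt_19 (z : ℂ) :
    let op : (ℝ × ℝ × ℝ × ℂ) → (ℝ × ℝ × ℝ × ℂ) → (ℝ × ℝ × ℝ × ℂ) :=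
      fun x y =>
        (x.1 + y.1, x.2.1 + y.2.1 + x.2.2.1 * y.1, x.2.2.1 + y.2.2.1,
          ((x.2.2.1 * y.1 ^ 2 / 2 + x.2.1 * y.1 : ℝ) : ℂ) * z
            + ((x.2.2.1 ^ 2 * y.1 / 2 + x.2.2.1 * y.2.1 : ℝ) : ℂ) * (starRingEnd ℂ z)
            + x.2.2.2 + y.2.2.2)
    (∀ x y w : ℝ × ℝ × ℝ × ℂ, op (op x y) w = op x (op y w)) ∧
    (∀ x : ℝ × ℝ × ℝ × ℂ, op (0, 0, 0, 0) x = x ∧ op x (0, 0, 0, 0) = x) ∧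
    (∀ x : ℝ × ℝ × ℝ × ℂ, ∃ y : ℝ × ℝ × ℝ × ℂ,
      op x y = (0, 0, 0, 0) ∧ op y x = (0, 0, 0, 0)) := by
  intro op
  refine ⟨?_, ?_, ?_⟩
  · rintro ⟨a, b, c, d⟩ ⟨p, q, r, s⟩ ⟨t, u, v, w⟩
    simp only [op, Prod.mk.injEq]
    refine ⟨by ring, by ring, by ring, ?_⟩
    push_cast
    ring
  · rintro ⟨a, b, c, d⟩
    simp [op]
  · rintro ⟨a, b, c, d⟩
    refine ⟨(-a, -b + c * a, -c,
      -((c * a ^ 2 / 2 - b * a : ℝ) : ℂ) * z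
        - ((c ^ 2 * a / 2 - c * b : ℝ) : ℂ) * (starRingEnd ℂ z) - d), ?_, ?_⟩
    all_goals
      simp only [op, Prod.mk.injEq]
      refine ⟨by ring, by ring, by ring, ?_⟩
      push_cast
      ring
end
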